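/- arXiv:1604.04665 — 4 statements merged into one kernel-verified Lean document; each statement's English description precedes it below -/
import Mathlib

section
/- Let V be a real vector space, N ≥ 2, and for n = 1, …, N let B_n : V × V → ℝ be symmetric positive-semidefinite bilinear forms. Assume there are constants c ≥ 0 and step sizes τ_n > 0 such that B_n(v, v) ≤ (1 + c τ_n) B_{n-1}(v, v) for all v ∈ V and all n = 2, …, N. Then for every sequence E_1, …, E_N in V and every l with 2 ≤ l ≤ N one has 2 · Σ_{n=2}^{l} B_n(E_n, E_n − E_{n−1}) ≥ Σ_{n=2}^{l} B_n(E_n − E_{n−1}, E_n − E_{n−1}) + B_l(E_l, E_l) − B_1(E_1, E_1) − c · Σ_{n=2}^{l} τ_n B_{n−1}(E_{n−1}, E_{n−1}). -/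
open Finset

/-- Polarization identity for a symmetric bilinear form. -/
theorem two_mul_apply_sub_of_symm {V : Type*} [AddCommGroup V] [Module ℝ V]
    (B : LinearMap.BilinForm ℝ V) (hB : ∀ v w : V, B v w = B w v) (x y : V) :
    2 * B x (x - y) = B (x - y) (x - y) + B x x - B y y := by
  simp only [map_sub, LinearMap.sub_apply, hB y x]
  ring

/-- Discrete energy (summation-by-parts) inequality for a family of symmetric
positive-semidefinite bilinear forms `B n` comparing up to a factor `1 + c * τ n`. -/
theorem stmt_0 {V : Type*} [AddCommGroup V] [Module ℝ V]
    (N : ℕ) (hN : 2 ≤ N)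
    (B : ℕ → LinearMap.BilinForm ℝ V)
    (hsymm : ∀ n, 1 ≤ n → n ≤ N → ∀ v w : V, B n v w = B n w v)
    (hpsd : ∀ n, 1 ≤ n → n ≤ N → ∀ v : V, 0 ≤ B n v v)
    (c : ℝ) (hc : 0 ≤ c) (τ : ℕ → ℝ) (hτ : ∀ n, 1 ≤ n → n ≤ N → 0 < τ n)
    (hcomp : ∀ n, 2 ≤ n → n ≤ N → ∀ v : V,
      B n v v ≤ (1 + c * τ n) * B (n - 1) v v)
    (E : ℕ → V) (l : ℕ) (hl2 : 2 ≤ l) (hlN : l ≤ N) :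
    2 * ∑ n ∈ Finset.Icc 2 l, B n (E n) (E n - E (n - 1)) ≥
      ∑ n ∈ Finset.Icc 2 l, B n (E n - E (n - 1)) (E n - E (n - 1))
        + B l (E l) (E l) - B 1 (E 1) (E 1)
        - c * ∑ n ∈ Finset.Icc 2 l, τ n * B (n - 1) (E (n - 1)) (E (n - 1)) := by
  induction l, hl2 using Nat.le_induction with
  | base =>
    have hpol := two_mul_apply_sub_of_symm (B 2) (hsymm 2 (by omega) hlN) (E 2) (E 1)
    have hcmp := hcomp 2 le_rfl hlN (E 1)
    simp only [Finset.Icc_self, Finset.sum_singleton, Nat.add_one_sub_one] at hcmp ⊢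
    linarith
  | succ k hk ih =>
    have hpol := two_mul_apply_sub_of_symm (B (k + 1)) (hsymm (k + 1) (by omega) hlN)
      (E (k + 1)) (E k)
    have hcmp := hcomp (k + 1) (by omega) hlN (E k)
    have hsum := ih (by omega)
    simp only [Finset.sum_Icc_succ_top (show 2 ≤ k + 1 by omega), Nat.add_sub_cancel]
      at hcmp ⊢
    linarith
end

section
/- Let H be a real inner product space, let l ≥ 2, let e_1, …, e_l ∈ H, and let w_2, …, w_l be real weights satisfying μ ≤ w_n ≤ W for all n (with 0 < μ ≤ W) and |w_{n+1} − w_n| ≤ δ_n for 2 ≤ n ≤ l − 1, where δ_n ≥ 0. Then Σ_{n=2}^{l} w_n ⟨e_n, e_n − e_{n−1}⟩ ≥ (μ/2) Σ_{n=2}^{l} ‖e_n − e_{n−1}‖² + (μ/2) ‖e_l‖² − (W/2) ‖e_1‖² − (1/2) Σ_{n=2}^{l−1} δ_n ‖e_n‖². -/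
open Finset RealInnerProductSpace

/-- The polarization identity `⟪a, a - b⟫ = (‖a‖² - ‖b‖² + ‖a - b‖²) / 2`. -/
theorem real_inner_self_sub_eq {H : Type*} [NormedAddCommGroup H] [InnerProductSpace ℝ H]
    (a b : H) : ⟪a, a - b⟫ = (‖a‖ ^ 2 - ‖b‖ ^ 2 + ‖a - b‖ ^ 2) / 2 := by
  rw [norm_sub_sq_real, inner_sub_right, real_inner_self_eq_norm_sq]
  ring

/-- Abel-summation lower bound keeping the last weight `w l` as coefficient of `‖e l‖²`. -/
theorem weighted_abel_lower_bound {H : Type*} [NormedAddCommGroup H] [InnerProductSpace ℝ H]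
    (l : ℕ) (hl : 2 ≤ l) (e : ℕ → H) (w : ℕ → ℝ) (μ : ℝ) (δ : ℕ → ℝ)
    (hwl : ∀ n, 2 ≤ n → n ≤ l → μ ≤ w n)
    (hδ : ∀ n, 2 ≤ n → n ≤ l - 1 → |w (n + 1) - w n| ≤ δ n) :
    (μ / 2) * ∑ n ∈ Finset.Icc 2 l, ‖e n - e (n - 1)‖ ^ 2
        + (w l / 2) * ‖e l‖ ^ 2 - (w 2 / 2) * ‖e 1‖ ^ 2
        - (1 / 2) * ∑ n ∈ Finset.Icc 2 (l - 1), δ n * ‖e n‖ ^ 2 ≤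
      ∑ n ∈ Finset.Icc 2 l, w n * ⟪e n, e n - e (n - 1)⟫ := by
  induction l, hl using Nat.le_induction with
  | base =>
    have h := mul_le_mul_of_nonneg_right (hwl 2 le_rfl le_rfl) (sq_nonneg ‖e 2 - e 1‖)
    simp only [Finset.Icc_self, Finset.sum_singleton, real_inner_self_sub_eq, Nat.reduceSub,
      Finset.Icc_eq_empty_of_lt one_lt_two, Finset.sum_empty]
    linarith
  | succ m hm ih =>
    have ih := ih (fun n h₁ h₂ => hwl n h₁ (by omega)) (fun n h₁ h₂ => hδ n h₁ (by omega))
    have hinc := mul_le_mul_of_nonneg_right (hwl (m + 1) (by omega) le_rfl)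
      (sq_nonneg ‖e (m + 1) - e m‖)
    have hvar := mul_le_mul_of_nonneg_right
      ((le_abs_self _).trans (hδ m hm (by omega))) (sq_nonneg ‖e m‖)
    have hsum : ∑ n ∈ Finset.Icc 2 m, δ n * ‖e n‖ ^ 2 =
        ∑ n ∈ Finset.Icc 2 (m - 1), δ n * ‖e n‖ ^ 2 + δ m * ‖e m‖ ^ 2 := by
      obtain ⟨k, rfl⟩ : ∃ k, m = k + 1 := ⟨m - 1, by omega⟩
      exact Finset.sum_Icc_succ_top hm _
    rw [Finset.sum_Icc_succ_top (by omega), Finset.sum_Icc_succ_top (by omega),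
      Nat.add_sub_cancel, hsum, real_inner_self_sub_eq]
    linarith

/-- Weighted Abel-summation lower bound: for weights `w n` bounded between `μ` and `W`
with consecutive differences bounded by `δ n`, the weighted sum of
`⟪e n, e n - e (n-1)⟫` is bounded below in terms of the increments and endpoint norms. -/
theorem stmt_1 {H : Type*} [NormedAddCommGroup H] [InnerProductSpace ℝ H]
    (l : ℕ) (hl : 2 ≤ l) (e : ℕ → H) (w : ℕ → ℝ) (μ W : ℝ) (δ : ℕ → ℝ)
    (hμ : 0 < μ) (hμW : μ ≤ W)
    (hwl : ∀ n, 2 ≤ n → n ≤ l → μ ≤ w n)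
    (hwu : ∀ n, 2 ≤ n → n ≤ l → w n ≤ W)
    (hδ : ∀ n, 2 ≤ n → n ≤ l - 1 → |w (n + 1) - w n| ≤ δ n)
    (hδ0 : ∀ n, 2 ≤ n → n ≤ l - 1 → 0 ≤ δ n) :
    ∑ n ∈ Finset.Icc 2 l, w n * ⟪e n, e n - e (n - 1)⟫ ≥
      (μ / 2) * ∑ n ∈ Finset.Icc 2 l, ‖e n - e (n - 1)‖ ^ 2
        + (μ / 2) * ‖e l‖ ^ 2 - (W / 2) * ‖e 1‖ ^ 2
        - (1 / 2) * ∑ n ∈ Finset.Icc 2 (l - 1), δ n * ‖e n‖ ^ 2 := by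
  have h := weighted_abel_lower_bound l hl e w μ δ hwl hδ
  have hlast := mul_le_mul_of_nonneg_right (hwl l hl le_rfl) (sq_nonneg ‖e l‖)
  have hfirst := mul_le_mul_of_nonneg_right (hwu 2 le_rfl hl) (sq_nonneg ‖e 1‖)
  linarith
end

section
/- Let E be a real Banach space, let a < b be real numbers, and let f : ℝ → E be differentiable on [a, b] with derivative f′ such that t ↦ ‖f′(t)‖² is integrable on [a, b]. Then ‖ f(b) − (1/(b − a)) ∫_a^b f(t) dt ‖ ≤ (2/3) (b − a)^{1/2} ( ∫_a^b ‖f′(t)‖² dt )^{1/2}. -/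
open MeasureTheory Set

/-- On `[a, b]`, a derivative whose squared norm is integrable is itself square integrable in the
sense of `MemLp`; measurability is automatic for a derivative. -/
theorem memLp_two_of_hasDerivWithinAt_Icc {E : Type*} [NormedAddCommGroup E] [NormedSpace ℝ E]
    [CompleteSpace E] {a b : ℝ} {f f' : ℝ → E}
    (hderiv : ∀ t ∈ Icc a b, HasDerivWithinAt f (f' t) (Icc a b) t)
    (hint : IntegrableOn (fun t => ‖f' t‖ ^ 2) (Icc a b)) :
    MemLp f' 2 (volume.restrict (Icc a b)) := by
  have hmeas : AEStronglyMeasurable f' (volume.restrict (Icc a b)) := by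
    rw [← Measure.restrict_congr_set Ioo_ae_eq_Icc]
    refine (stronglyMeasurable_deriv f).aestronglyMeasurable.congr ?_
    filter_upwards [ae_restrict_mem measurableSet_Ioo] with t ht
    exact ((hderiv t (Ioo_subset_Icc_self ht)).hasDerivAt (Icc_mem_nhds ht.1 ht.2)).deriv
  exact (memLp_two_iff_integrable_sq_norm hmeas).2 hint

/-- The Hölder-`1/2` estimate for a function with square integrable derivative. -/
theorem norm_sub_le_rpow_mul_integral_sq_rpow {E : Type*} [NormedAddCommGroup E]
    [NormedSpace ℝ E] [CompleteSpace E] {a b : ℝ} (hab : a ≤ b) {f f' : ℝ → E}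
    (hderiv : ∀ t ∈ Icc a b, HasDerivWithinAt f (f' t) (Icc a b) t)
    (hint : IntegrableOn (fun t => ‖f' t‖ ^ 2) (Icc a b)) :
    ‖f b - f a‖ ≤
      (b - a) ^ ((1 : ℝ) / 2) * (∫ t in a..b, ‖f' t‖ ^ 2) ^ ((1 : ℝ) / 2) := by
  have hmem : MemLp f' 2 (volume.restrict (Ioc a b)) := by
    rw [Measure.restrict_congr_set Ioc_ae_eq_Icc]
    exact memLp_two_of_hasDerivWithinAt_Icc hderiv hint
  have hii : IntervalIntegrable f' volume a b :=
    (intervalIntegrable_iff_integrableOn_Ioc_of_le hab).2 (hmem.integrable one_le_two)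
  have hftc : ∫ t in a..b, f' t = f b - f a :=
    intervalIntegral.integral_eq_sub_of_hasDerivAt_of_le hab
      (fun t ht => (hderiv t ht).continuousWithinAt)
      (fun t ht => (hderiv t (Ioo_subset_Icc_self ht)).hasDerivAt (Icc_mem_nhds ht.1 ht.2)) hii
  have hholder := integral_mul_norm_le_Lp_mul_Lq (μ := volume.restrict (Ioc a b))
    (f := fun _ => (1 : ℝ)) (g := fun t => ‖f' t‖) Real.HolderConjugate.two_two
    (by simpa using memLp_const (1 : ℝ)) (by simpa using hmem.norm)
  calc ‖f b - f a‖ ≤ ∫ t in a..b, ‖f' t‖ := by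
        rw [← hftc]; exact intervalIntegral.norm_integral_le_integral_norm hab
    _ ≤ _ := by
        rw [intervalIntegral.integral_of_le hab, intervalIntegral.integral_of_le hab]
        simpa [hab] using hholder

/-- One-interval quadrature error estimate: the deviation of the endpoint value of a
function from its time average over `[a, b]` is bounded by
`(2/3) √(b-a) (∫_a^b ‖f'‖²)^(1/2)`. -/
theorem stmt_2 {E : Type*} [NormedAddCommGroup E] [NormedSpace ℝ E] [CompleteSpace E]
    (a b : ℝ) (hab : a < b) (f f' : ℝ → E)
    (hderiv : ∀ t ∈ Set.Icc a b, HasDerivWithinAt f (f' t) (Set.Icc a b) t)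
    (hint : MeasureTheory.IntegrableOn (fun t => ‖f' t‖ ^ 2) (Set.Icc a b)) :
    ‖f b - (1 / (b - a)) • ∫ t in a..b, f t‖ ≤
      (2 / 3) * (b - a) ^ ((1 : ℝ) / 2) * (∫ t in a..b, ‖f' t‖ ^ 2) ^ ((1 : ℝ) / 2) := by
  have hpos : 0 < b - a := sub_pos.2 hab
  have hf : IntervalIntegrable f volume a b :=
    ContinuousOn.intervalIntegrable_of_Icc hab.le fun t ht => (hderiv t ht).continuousWithinAt
  set L : ℝ := (∫ t in a..b, ‖f' t‖ ^ 2) ^ ((1 : ℝ) / 2)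
  have hpoint : ∀ t ∈ Ioc a b, ‖f b - f t‖ ≤ (b - t) ^ ((1 : ℝ) / 2) * L := by
    intro t ht
    have hsub : Icc t b ⊆ Icc a b := Icc_subset_Icc_left ht.1.le
    refine (norm_sub_le_rpow_mul_integral_sq_rpow ht.2
      (fun s hs => (hderiv s (hsub hs)).mono hsub) (hint.mono_set hsub)).trans ?_
    have hmono : ∫ s in t..b, ‖f' s‖ ^ 2 ≤ ∫ s in a..b, ‖f' s‖ ^ 2 :=
      intervalIntegral.integral_mono_interval ht.1.le ht.2 le_rfl
        (Filter.Eventually.of_forall fun s => sq_nonneg ‖f' s‖)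
        ((intervalIntegrable_iff_integrableOn_Icc_of_le hab.le).2 hint)
    have hnn : 0 ≤ ∫ s in t..b, ‖f' s‖ ^ 2 :=
      intervalIntegral.integral_nonneg ht.2 fun s _ => sq_nonneg ‖f' s‖
    exact mul_le_mul_of_nonneg_left (Real.rpow_le_rpow hnn hmono (by norm_num))
      (Real.rpow_nonneg (sub_nonneg.2 ht.2) _)
  have hmean : f b - (1 / (b - a)) • ∫ t in a..b, f t
      = (1 / (b - a)) • ∫ t in a..b, (f b - f t) := by
    rw [intervalIntegral.integral_sub intervalIntegrable_const hf,
      intervalIntegral.integral_const, smul_sub, smul_smul, one_div_mul_cancel hpos.ne', one_smul]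
  have hroot : ∫ t in a..b, (b - t) ^ ((1 : ℝ) / 2)
      = (2 / 3) * ((b - a) ^ ((1 : ℝ) / 2) * (b - a)) := by
    rw [intervalIntegral.integral_comp_sub_left (fun x : ℝ => x ^ ((1 : ℝ) / 2)) b,
      integral_rpow (Or.inl (by norm_num)), sub_self, Real.zero_rpow (by norm_num),
      Real.rpow_add_one hpos.ne']
    ring
  have hcont : Continuous fun t : ℝ => (b - t) ^ ((1 : ℝ) / 2) * L :=
    ((continuous_const.sub continuous_id).rpow_const fun _ => Or.inr (by norm_num)).mul_const L
  have hbound : ‖∫ t in a..b, (f b - f t)‖ ≤ ∫ t in a..b, (b - t) ^ ((1 : ℝ) / 2) * L :=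
    intervalIntegral.norm_integral_le_of_norm_le hab.le
      (Filter.Eventually.of_forall hpoint) (hcont.intervalIntegrable a b)
  rw [intervalIntegral.integral_mul_const, hroot] at hbound
  rw [hmean, norm_smul, Real.norm_of_nonneg (one_div_pos.2 hpos).le]
  calc 1 / (b - a) * ‖∫ t in a..b, (f b - f t)‖
      ≤ 1 / (b - a) * ((2 / 3) * ((b - a) ^ ((1 : ℝ) / 2) * (b - a)) * L) := by gcongr
    _ = (2 / 3) * (b - a) ^ ((1 : ℝ) / 2) * L := by field_simp
end

section
/- Let E be a real Banach space, let 0 = t_0 < t_1 < ⋯ < t_N = T be a partition of [0, T] with step sizes τ_n = t_n − t_{n−1} and τ = max_{1 ≤ n ≤ N} τ_n, and let f : ℝ → E be differentiable on [0, T] with derivative f′ such that t ↦ ‖f′(t)‖² is integrable on [0, T]. Then Σ_{n=1}^{N} τ_n ‖ f(t_n) − (1/τ_n) ∫_{t_{n−1}}^{t_n} f(t) dt ‖² ≤ τ² ∫_0^T ‖f′(t)‖² dt. -/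
open Finset

/-- If the square of a nonnegative function is integrable on `[a, b]`, so is the function. -/
theorem integrableOn_Icc_of_sq {g : ℝ → ℝ} {a b : ℝ} (hg : ∀ s, 0 ≤ g s)
    (hint : MeasureTheory.IntegrableOn (fun s => g s ^ 2) (Set.Icc a b)) :
    MeasureTheory.IntegrableOn g (Set.Icc a b) := by
  have hmeas : MeasureTheory.AEStronglyMeasurable g
      (MeasureTheory.volume.restrict (Set.Icc a b)) := by
    have h := Real.continuous_sqrt.comp_aestronglyMeasurable hint.aestronglyMeasurable
    simpa only [Real.sqrt_sq (hg _)] using h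
  have hone : MeasureTheory.IntegrableOn (fun _ : ℝ => (1 : ℝ)) (Set.Icc a b) :=
    MeasureTheory.integrableOn_const (by simp)
  refine (hone.add hint).mono' hmeas (Filter.Eventually.of_forall fun s => ?_)
  rw [Real.norm_of_nonneg (hg s)]
  simp only [Pi.add_apply]
  nlinarith [sq_nonneg (g s - 1)]

/-- Cauchy–Schwarz inequality against the constant function on an interval. -/
theorem sq_intervalIntegral_le {g : ℝ → ℝ} {a b : ℝ} (hab : a < b)
    (hg : IntervalIntegrable g MeasureTheory.volume a b)
    (hg2 : IntervalIntegrable (fun s => g s ^ 2) MeasureTheory.volume a b) :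
    (∫ s in a..b, g s) ^ 2 ≤ (b - a) * ∫ s in a..b, g s ^ 2 := by
  have hpos : 0 < b - a := sub_pos.mpr hab
  set G := ∫ s in a..b, g s with hG
  have hnonneg : 0 ≤ ∫ s in a..b, ((b - a) * g s - G) ^ 2 :=
    intervalIntegral.integral_nonneg hab.le fun s _ => sq_nonneg _
  have hexpand : ∫ s in a..b, ((b - a) * g s - G) ^ 2 =
      (b - a) ^ 2 * (∫ s in a..b, g s ^ 2) - 2 * (b - a) * G * G + (b - a) * G ^ 2 := by
    have hfun : (fun s => ((b - a) * g s - G) ^ 2) =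
        fun s => (b - a) ^ 2 * g s ^ 2 - 2 * (b - a) * G * g s + G ^ 2 := by
      funext s; ring
    rw [hfun, intervalIntegral.integral_add
        ((hg2.const_mul _).sub (hg.const_mul _)) intervalIntegrable_const,
      intervalIntegral.integral_sub (hg2.const_mul _) (hg.const_mul _),
      intervalIntegral.integral_const_mul, intervalIntegral.integral_const_mul,
      intervalIntegral.integral_const, ← hG, smul_eq_mul]
  rw [hexpand] at hnonneg
  refine le_of_mul_le_mul_left ?_ hpos
  nlinarith

section

variable {E : Type*} [NormedAddCommGroup E] [NormedSpace ℝ E]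

/-- Mean value inequality in integral form, with no measurability assumption on the derivative. -/
theorem norm_sub_le_integral_norm_deriv {f f' : ℝ → E} {a b : ℝ} (hab : a ≤ b)
    (hderiv : ∀ s ∈ Set.Icc a b, HasDerivWithinAt f (f' s) (Set.Icc a b) s)
    (hint : MeasureTheory.IntegrableOn (fun s => ‖f' s‖) (Set.Icc a b)) :
    ‖f b - f a‖ ≤ ∫ s in a..b, ‖f' s‖ := by
  obtain ⟨φ, hφ, hφv⟩ := exists_dual_vector'' ℝ (f b - f a)
  have hφderiv : ∀ s ∈ Set.Icc a b,
      HasDerivWithinAt (fun x => φ (f x)) (φ (f' s)) (Set.Icc a b) s := fun s hs =>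
    φ.hasFDerivAt.comp_hasDerivWithinAt s (hderiv s hs)
  have hle : φ (f b) - φ (f a) ≤ ∫ s in a..b, ‖f' s‖ := by
    refine intervalIntegral.sub_le_integral_of_hasDeriv_right_of_le hab
      (fun s hs => (hφderiv s hs).continuousWithinAt) (g' := fun s => φ (f' s))
      (fun s hs => ?_) hint fun s _ => ?_
    · exact (hφderiv s (Set.Ioo_subset_Icc_self hs)).hasDerivAt
        (Icc_mem_nhds hs.1 hs.2) |>.hasDerivWithinAt
    · exact (le_abs_self _).trans <| (φ.le_of_opNorm_le hφ _).trans_eq (one_mul _)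
  rw [← map_sub, hφv] at hle
  exact hle

/-- Error of the right-endpoint value against the mean value on a single interval. -/
theorem mul_norm_sub_average_sq_le [CompleteSpace E] {f f' : ℝ → E} {a b : ℝ} (hab : a < b)
    (hderiv : ∀ s ∈ Set.Icc a b, HasDerivWithinAt f (f' s) (Set.Icc a b) s)
    (hint : MeasureTheory.IntegrableOn (fun s => ‖f' s‖ ^ 2) (Set.Icc a b)) :
    (b - a) * ‖f b - (1 / (b - a)) • ∫ s in a..b, f s‖ ^ 2 ≤
      (b - a) ^ 2 * ∫ s in a..b, ‖f' s‖ ^ 2 := by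
  have hpos : 0 < b - a := sub_pos.mpr hab
  have hint1 := integrableOn_Icc_of_sq (fun s => norm_nonneg (f' s)) hint
  have hii1 : IntervalIntegrable (fun s => ‖f' s‖) MeasureTheory.volume a b :=
    (intervalIntegrable_iff_integrableOn_Icc_of_le hab.le).mpr hint1
  have hii2 : IntervalIntegrable (fun s => ‖f' s‖ ^ 2) MeasureTheory.volume a b :=
    (intervalIntegrable_iff_integrableOn_Icc_of_le hab.le).mpr hint
  have hf : IntervalIntegrable f MeasureTheory.volume a b :=
    ContinuousOn.intervalIntegrable_of_Icc hab.le fun s hs => (hderiv s hs).continuousWithinAt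
  have hpoint : ∀ s ∈ Set.uIoc a b, ‖f b - f s‖ ≤ ∫ r in a..b, ‖f' r‖ := by
    intro s hs
    rw [Set.uIoc_of_le hab.le] at hs
    have hsub : Set.Icc s b ⊆ Set.Icc a b := Set.Icc_subset_Icc_left hs.1.le
    refine (norm_sub_le_integral_norm_deriv hs.2
      (fun r hr => (hderiv r (hsub hr)).mono hsub) (hint1.mono_set hsub)).trans ?_
    exact intervalIntegral.integral_mono_interval hs.1.le hs.2 le_rfl
      (Filter.Eventually.of_forall fun r => norm_nonneg _) hii1
  have havg : f b - (1 / (b - a)) • ∫ s in a..b, f s =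
      (1 / (b - a)) • ∫ s in a..b, (f b - f s) := by
    rw [intervalIntegral.integral_sub intervalIntegrable_const hf,
      intervalIntegral.integral_const, smul_sub, smul_smul, one_div_mul_cancel hpos.ne',
      one_smul]
  have hnorm : ‖f b - (1 / (b - a)) • ∫ s in a..b, f s‖ ≤ ∫ r in a..b, ‖f' r‖ := by
    have h := intervalIntegral.norm_integral_le_of_norm_le_const hpoint
    rw [abs_of_pos hpos] at h
    rw [havg, norm_smul, Real.norm_of_nonneg (by positivity), one_div_mul_eq_div,
      div_le_iff₀ hpos]
    exact h
  calc (b - a) * ‖f b - (1 / (b - a)) • ∫ s in a..b, f s‖ ^ 2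
      ≤ (b - a) * (∫ r in a..b, ‖f' r‖) ^ 2 := by gcongr
    _ ≤ (b - a) * ((b - a) * ∫ s in a..b, ‖f' s‖ ^ 2) := by
        gcongr
        exact sq_intervalIntegral_le hab hii1 hii2
    _ = (b - a) ^ 2 * ∫ s in a..b, ‖f' s‖ ^ 2 := by ring

end

/-- Summed quadrature-error estimate over a time grid `0 = t 0 < t 1 < ⋯ < t N = T`:
`∑_n τ_n ‖f(t_n) − τ_n⁻¹ ∫_{t_{n-1}}^{t_n} f‖² ≤ τ² ∫_0^T ‖f'‖²`,
where `τ_n = t n - t (n-1)` and `τ = max_n τ_n`. -/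
theorem stmt_3 {E : Type*} [NormedAddCommGroup E] [NormedSpace ℝ E] [CompleteSpace E]
    (N : ℕ) (hN : 1 ≤ N) (T : ℝ) (t : ℕ → ℝ)
    (ht0 : t 0 = 0) (htN : t N = T)
    (hmono : ∀ n, n < N → t n < t (n + 1))
    (τ : ℝ)
    (hτ : τ = (Finset.Icc 1 N).sup' (Finset.nonempty_Icc.mpr hN)
      (fun n => t n - t (n - 1)))
    (f f' : ℝ → E)
    (hderiv : ∀ s ∈ Set.Icc (0 : ℝ) T, HasDerivWithinAt f (f' s) (Set.Icc (0 : ℝ) T) s)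
    (hint : MeasureTheory.IntegrableOn (fun s => ‖f' s‖ ^ 2) (Set.Icc (0 : ℝ) T)) :
    ∑ n ∈ Finset.Icc 1 N, (t n - t (n - 1)) *
        ‖f (t n) - (1 / (t n - t (n - 1))) • ∫ s in (t (n - 1))..(t n), f s‖ ^ 2 ≤
      τ ^ 2 * ∫ s in (0 : ℝ)..T, ‖f' s‖ ^ 2 := by
  have hmonoOn : ∀ m n, m ≤ n → n ≤ N → t m ≤ t n := by
    intro m n hmn
    induction n, hmn using Nat.le_induction with
    | base => exact fun _ => le_rfl
    | succ n _ ih => exact fun hn => (ih (by omega)).trans (hmono n (by omega)).le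
  have hsub : ∀ n < N, Set.Icc (t n) (t (n + 1)) ⊆ Set.Icc 0 T := fun n hn =>
    Set.Icc_subset_Icc (ht0 ▸ hmonoOn 0 n (Nat.zero_le n) hn.le)
      (htN ▸ hmonoOn (n + 1) N hn le_rfl)
  have hadj : ∑ n ∈ Finset.range N, ∫ s in (t n)..(t (n + 1)), ‖f' s‖ ^ 2 =
      ∫ s in (0 : ℝ)..T, ‖f' s‖ ^ 2 := by
    rw [intervalIntegral.sum_integral_adjacent_intervals, ht0, htN]
    exact fun n hn => (intervalIntegrable_iff_integrableOn_Icc_of_le (hmono n hn).le).mpr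
      (hint.mono_set (hsub n hn))
  have hstep : ∀ n < N, t (n + 1) - t n ≤ τ := fun n hn => by
    rw [hτ]
    exact Finset.le_sup' (fun n => t n - t (n - 1))
      (Finset.mem_Icc.mpr ⟨Nat.le_add_left 1 n, hn⟩)
  rw [← hadj, Finset.mul_sum, ← Finset.Ico_add_one_right_eq_Icc, Finset.sum_Ico_eq_sum_range]
  simp only [Nat.add_sub_cancel, Nat.add_comm 1]
  refine Finset.sum_le_sum fun n hn => ?_
  have hn : n < N := Finset.mem_range.mp hn
  refine (mul_norm_sub_average_sq_le (hmono n hn)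
    (fun s hs => (hderiv s (hsub n hn hs)).mono (hsub n hn))
    (hint.mono_set (hsub n hn))).trans ?_
  refine mul_le_mul_of_nonneg_right
    (pow_le_pow_left₀ (sub_pos.mpr (hmono n hn)).le (hstep n hn) 2) ?_
  exact intervalIntegral.integral_nonneg (hmono n hn).le fun s _ => sq_nonneg _
end
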